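/- arXiv:2302.02215 — 2 statements merged into one kernel-verified Lean document; each statement's English description precedes it below -/
import Mathlib

section
/- Let G be a digraph, let s be a vertex from which every vertex of G is reachable, and let (x,y) be a bridge of the flow graph G_s. Then x is the immediate dominator of y, i.e., x is a proper dominator of y and every proper dominator z of y with z ≠ x is a proper dominator of x. -/
/-- A directed multigraph: a type `E` of potential edges with source and target
maps, together with the set of edges actually present in the digraph. -/
structure MultiDigraph (V : Type) (E : Type) where
  edges : Set E
  src : E → V
  tgt : E → V

namespace MultiDigraph

variable {V E : Type}

/-- `G.IsWalk u v l` : the list of edges `l` forms a walk from `u` to `v`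
(consecutive edges compose). -/
def IsWalk (G : MultiDigraph V E) : V → V → List E → Prop
  | u, v, [] => u = v
  | u, v, e :: l => e ∈ G.edges ∧ G.src e = u ∧ G.IsWalk (G.tgt e) v l

/-- A path from `u` to `v`: a walk using no edge more than once. -/
def IsTrail (G : MultiDigraph V E) (u v : V) (l : List E) : Prop :=
  G.IsWalk u v l ∧ l.Nodup

/-- `u` reaches `v`: there is a path from `u` to `v`. -/
def Reaches (G : MultiDigraph V E) (u v : V) : Prop :=
  ∃ l : List E, G.IsTrail u v l

/-- `u` and `v` are strongly connected: each reaches the other. -/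
def SConn (G : MultiDigraph V E) (u v : V) : Prop :=
  G.Reaches u v ∧ G.Reaches v u

/-- The digraph is strongly connected. -/
def StronglyConnected (G : MultiDigraph V E) : Prop :=
  ∀ u v : V, G.Reaches u v

/-- Delete the edge `e`. -/
def deleteEdge (G : MultiDigraph V E) (e : E) : MultiDigraph V E :=
  { G with edges := G.edges \ {e} }

/-- A strong bridge: an edge whose deletion destroys strong connectivity. -/
def IsStrongBridge (G : MultiDigraph V E) (e : E) : Prop :=
  e ∈ G.edges ∧ ¬ (G.deleteEdge e).StronglyConnected

end MultiDigraph

namespace MultiDigraph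

variable {V E : Type}

/-- `d` dominates `w` in the flow graph `G_s` : every path from `s` to `w`
contains the vertex `d`. -/
def Dominates (G : MultiDigraph V E) (s d w : V) : Prop :=
  ∀ l : List E, G.IsTrail s w l → (d = s ∨ ∃ e ∈ l, G.tgt e = d)

/-- `d` properly dominates `w` in `G_s`. -/
def ProperlyDominates (G : MultiDigraph V E) (s d w : V) : Prop :=
  G.Dominates s d w ∧ d ≠ w

/-- The edge `e` is a bridge of the flow graph `G_s` : every path from `s` to
the head of `e` contains the edge `e`. -/
def IsFlowBridge (G : MultiDigraph V E) (s : V) (e : E) : Prop :=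
  e ∈ G.edges ∧ ∀ l : List E, G.IsTrail s (G.tgt e) l → e ∈ l

end MultiDigraph

namespace MultiDigraph

variable {V E : Type}

theorem isWalk_append (G : MultiDigraph V E) (l₁ l₂ : List E) (u v : V) :
    G.IsWalk u v (l₁ ++ l₂) ↔ ∃ w, G.IsWalk u w l₁ ∧ G.IsWalk w v l₂ := by
  induction l₁ generalizing u with
  | nil => simp [IsWalk]
  | cons a l ih => simp [IsWalk, ih, and_assoc]

theorem IsWalk.eq_or_exists_tgt {G : MultiDigraph V E} {u v : V} {l : List E}
    (h : G.IsWalk u v l) : v = u ∨ ∃ e ∈ l, G.tgt e = v := by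
  induction l generalizing u with
  | nil => exact Or.inl (Eq.symm h)
  | cons a l ih =>
    obtain ⟨-, -, h⟩ := h
    rcases ih h with h | ⟨e, he, h⟩
    · exact Or.inr ⟨a, by simp, h.symm⟩
    · exact Or.inr ⟨e, by simp [he], h⟩

/-- A path through the edge `e` has an initial part that ends at the tail of `e` and avoids `e`. -/
theorem IsTrail.exists_trail_to_src {G : MultiDigraph V E} {u v : V} {l : List E}
    (h : G.IsTrail u v l) {e : E} (he : e ∈ l) :
    ∃ l' ⊆ l, e ∉ l' ∧ G.IsTrail u (G.src e) l' := by
  obtain ⟨l₁, l₂, rfl⟩ := List.append_of_mem he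
  obtain ⟨hw, hn⟩ := h
  obtain ⟨w, hw₁, -, rfl, -⟩ := (G.isWalk_append _ _ _ _).1 hw
  rw [List.nodup_append] at hn
  exact ⟨l₁, by simp, fun h => hn.2.2 e h e (by simp) rfl, hw₁, hn.1⟩

theorem IsTrail.concat {G : MultiDigraph V E} {u : V} {l : List E} {e : E}
    (h : G.IsTrail u (G.src e) l) (he : e ∈ G.edges) (hl : e ∉ l) :
    G.IsTrail u (G.tgt e) (l ++ [e]) :=
  ⟨(G.isWalk_append _ _ _ _).2 ⟨_, h.1, he, rfl, rfl⟩,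
    List.nodup_append.2 ⟨h.2, List.nodup_singleton e, fun _ ha _ hb hab =>
      hl (List.mem_singleton.1 hb ▸ hab ▸ ha)⟩⟩

end MultiDigraph

/-- If `(x,y)` is a bridge of the flow graph `G_s`, then `x`
is the immediate dominator of `y`: `x` properly dominates `y`, and every proper
dominator `z ≠ x` of `y` properly dominates `x`. -/
theorem statement_3 {V E : Type} (G : MultiDigraph V E) (s : V)
    (hreach : ∀ w : V, G.Reaches s w) (e : E) (hbr : G.IsFlowBridge s e)
    (x y : V) (hx : G.src e = x) (hy : G.tgt e = y) :
    G.ProperlyDominates s x y ∧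
      ∀ z : V, G.ProperlyDominates s z y → z ≠ x →
        G.ProperlyDominates s z x := by
  subst hx hy
  obtain ⟨he, hb⟩ := hbr
  refine ⟨⟨fun l hl => ?_, fun hxy => ?_⟩, fun z ⟨hz, hzy⟩ hzx => ⟨fun l hl => ?_, hzx⟩⟩
  · obtain ⟨l', hsub, -, hl'⟩ := hl.exists_trail_to_src (hb l hl)
    exact hl'.1.eq_or_exists_tgt.imp_right fun ⟨a, ha, h⟩ => ⟨a, hsub ha, h⟩
  · obtain ⟨l, hl⟩ := hreach (G.tgt e)
    obtain ⟨l', -, hel', hl'⟩ := hl.exists_trail_to_src (hb l hl)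
    exact hel' (hb l' (hxy ▸ hl'))
  · obtain ⟨l', hsub, hel', hl'⟩ : ∃ l' ⊆ l, e ∉ l' ∧ G.IsTrail s (G.src e) l' := by
      by_cases hel : e ∈ l
      · exact hl.exists_trail_to_src hel
      · exact ⟨l, List.Subset.refl l, hel, hl⟩
    rcases hz _ (hl'.concat he hel') with h | ⟨a, ha, h⟩
    · exact Or.inl h
    · rcases List.mem_append.1 ha with ha | ha
      · exact Or.inr ⟨a, hsub ha, h⟩
      · rw [List.mem_singleton.1 ha] at h
        exact absurd h.symm hzy
end

section
/- For every mixed graph G there exists a single orientation R of G such that for every strongly orientable block C of G, the subgraph of R induced by C is strongly connected. -/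
namespace MultiDigraph

variable {V E : Type}

/-- The subgraph of `G` induced by the vertex set `C` (keeping exactly the
edges with both endpoints in `C`). -/
def induce (G : MultiDigraph V E) (C : Set V) : MultiDigraph V E :=
  { G with edges := {e | e ∈ G.edges ∧ G.src e ∈ C ∧ G.tgt e ∈ C} }

end MultiDigraph

/-- A mixed graph: a set of directed edges (with carrier `E`) and a set of
undirected edges (with carrier `F`, each with two endpoints). -/
structure MixedGraph (V E F : Type) where
  dEdges : Set E
  dsrc : E → V
  dtgt : E → V
  uEdges : Set F
  ufst : F → V
  usnd : F → V

namespace MixedGraph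

variable {V E F : Type}

/-- The orientation of `G` determined by a choice `o` of a direction for each
undirected edge: all directed edges are kept, and each undirected edge is
replaced by exactly one of its two possible directions. -/
def orient (G : MixedGraph V E F) (o : F → Bool) : MultiDigraph V (E ⊕ F) where
  edges := Sum.inl '' G.dEdges ∪ Sum.inr '' G.uEdges
  src := fun p =>
    match p with
    | Sum.inl e => G.dsrc e
    | Sum.inr f => if o f then G.ufst f else G.usnd f
  tgt := fun p =>
    match p with
    | Sum.inl e => G.dtgt e
    | Sum.inr f => if o f then G.usnd f else G.ufst f

/-- Delete a directed edge of the mixed graph. -/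
def delD (G : MixedGraph V E F) (e : E) : MixedGraph V E F :=
  { G with dEdges := G.dEdges \ {e} }

/-- Delete an undirected edge of the mixed graph. -/
def delU (G : MixedGraph V E F) (f : F) : MixedGraph V E F :=
  { G with uEdges := G.uEdges \ {f} }

end MixedGraph

namespace MixedGraph

variable {V E F : Type}

/-- There is an orientation of `G` in which all vertices of `C` are pairwise
strongly connected. -/
def StronglyOrientable (G : MixedGraph V E F) (C : Set V) : Prop :=
  ∃ o : F → Bool, ∀ a ∈ C, ∀ b ∈ C, (G.orient o).SConn a b

/-- A strongly orientable block: a maximal set of vertices `C` such that some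
orientation of `G` makes all vertices of `C` pairwise strongly connected. -/
def IsSOBlock (G : MixedGraph V E F) (C : Set V) : Prop :=
  G.StronglyOrientable C ∧
    ∀ C' : Set V, C ⊆ C' → G.StronglyOrientable C' → C' = C

end MixedGraph

namespace MultiDigraph

variable {V E : Type}

/-- `u` and `v` are joined by a directed edge of `G`. -/
def Step (G : MultiDigraph V E) (u v : V) : Prop :=
  ∃ e ∈ G.edges, G.src e = u ∧ G.tgt e = v

theorem IsWalk.reflTransGen {G : MultiDigraph V E} {u v : V} {l : List E}
    (h : G.IsWalk u v l) : Relation.ReflTransGen G.Step u v := by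
  induction l generalizing u with
  | nil => cases h; exact .refl
  | cons e l ih => exact .head ⟨e, h.1, h.2.1, rfl⟩ (ih h.2.2)

/-- A trail through `e` contains a trail starting at the source of `e`. -/
theorem IsTrail.reaches_src {G : MultiDigraph V E} {u v : V} {l : List E} {e : E}
    (h : G.IsTrail u v l) (he : e ∈ l) : G.Reaches (G.src e) v := by
  induction l generalizing u with
  | nil => cases he
  | cons d l ih =>
    obtain ⟨⟨hd, hu, hw⟩, hn⟩ := h
    rcases List.mem_cons.1 he with rfl | he
    · exact ⟨e :: l, ⟨hd, rfl, hw⟩, hn⟩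
    · exact ih ⟨hw, (List.nodup_cons.1 hn).2⟩ he

theorem reaches_iff_reflTransGen {G : MultiDigraph V E} {u v : V} :
    G.Reaches u v ↔ Relation.ReflTransGen G.Step u v := by
  refine ⟨fun ⟨_, h⟩ => h.1.reflTransGen, fun h => ?_⟩
  induction h using Relation.ReflTransGen.head_induction_on with
  | refl => exact ⟨[], rfl, List.nodup_nil⟩
  | head hstep _ ih =>
    obtain ⟨e, he, rfl, rfl⟩ := hstep
    obtain ⟨l, hl⟩ := ih
    by_cases hel : e ∈ l
    · exact hl.reaches_src hel
    · exact ⟨e :: l, ⟨he, rfl, hl.1⟩, List.nodup_cons.2 ⟨hel, hl.2⟩⟩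

theorem Reaches.refl (G : MultiDigraph V E) (u : V) : G.Reaches u u :=
  reaches_iff_reflTransGen.2 .refl

theorem Reaches.trans {G : MultiDigraph V E} {u v w : V}
    (h : G.Reaches u v) (h' : G.Reaches v w) : G.Reaches u w :=
  reaches_iff_reflTransGen.2
    ((reaches_iff_reflTransGen.1 h).trans (reaches_iff_reflTransGen.1 h'))

theorem Step.reaches {G : MultiDigraph V E} {u v : V} (h : G.Step u v) : G.Reaches u v :=
  reaches_iff_reflTransGen.2 (.single h)

/-- If each edge of `G` can be replaced by a path of `H`, so can each path of `G`. -/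
theorem Reaches.lift {E' : Type} {G : MultiDigraph V E} {H : MultiDigraph V E'}
    (hGH : ∀ u v, G.Step u v → H.Reaches u v) {u v : V} (h : G.Reaches u v) :
    H.Reaches u v := by
  rw [reaches_iff_reflTransGen] at h
  induction h with
  | refl => exact .refl H u
  | tail _ hstep ih => exact ih.trans (hGH _ _ hstep)

theorem Reaches.of_induce {H : MultiDigraph V E} {C : Set V} {u v : V}
    (h : (H.induce C).Reaches u v) : H.Reaches u v :=
  h.lift fun _ _ ⟨e, he, hs, ht⟩ => Step.reaches ⟨e, he.1, hs, ht⟩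

/-- Paths between vertices of a strong component stay inside that component. -/
theorem Reaches.induce_component {G : MultiDigraph V E} {a x b : V}
    (hxb : G.Reaches x b) (hax : G.Reaches a x) (hba : G.Reaches b a) :
    (G.induce {y | G.SConn a y}).Reaches x b := by
  have h := reaches_iff_reflTransGen.1 hxb
  induction h using Relation.ReflTransGen.head_induction_on with
  | refl => exact .refl _ _
  | head hstep hrest ih =>
    have hyb := reaches_iff_reflTransGen.2 hrest
    have hay := hax.trans hstep.reaches
    refine Reaches.trans (Step.reaches ?_) (ih hyb hay)
    obtain ⟨e, he, rfl, rfl⟩ := hstep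
    exact ⟨e, ⟨he, ⟨hax, hxb.trans hba⟩, ⟨hay, hyb.trans hba⟩⟩, rfl, rfl⟩

end MultiDigraph

namespace MixedGraph

variable {V E F : Type} {G : MixedGraph V E F}

/-- An orientation making a block strongly connected already does so inside the block. -/
theorem IsSOBlock.induce_reaches {C : Set V} (hC : G.IsSOBlock C) {o : F → Bool}
    (ho : ∀ a ∈ C, ∀ b ∈ C, (G.orient o).SConn a b) {a b : V} (ha : a ∈ C) (hb : b ∈ C) :
    ((G.orient o).induce C).Reaches a b := by
  have hcomp : {y | (G.orient o).SConn a y} = C :=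
    hC.2 _ (fun y hy => ho a ha y hy)
      ⟨o, fun x hx y hy => ⟨hx.2.trans hy.1, hy.2.trans hx.1⟩⟩
  have h := (ho a ha b hb).1.induce_component (.refl _ a) (ho a ha b hb).2
  rwa [hcomp] at h

/-- Orientations agreeing on the undirected edges inside `C` have the same edges inside `C`. -/
theorem step_induce_of_agree {C : Set V} {o o' : F → Bool}
    (hoo : ∀ f, G.ufst f ∈ C → G.usnd f ∈ C → o f = o' f) {u v : V}
    (h : ((G.orient o).induce C).Step u v) : ((G.orient o').induce C).Step u v := by
  obtain ⟨e | f, ⟨he, hs, ht⟩, rfl, rfl⟩ := h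
  · exact ⟨Sum.inl e, ⟨he, hs, ht⟩, rfl, rfl⟩
  · have hf : o f = o' f := by
      cases hof : o f <;> simp only [orient, hof] at hs ht
      · exact hof ▸ hoo f ht hs
      · exact hof ▸ hoo f hs ht
    refine ⟨Sum.inr f, ⟨he, ?_, ?_⟩, ?_, ?_⟩ <;>
      simp_all [MultiDigraph.induce, orient]

/-- Two strongly orientable blocks sharing a vertex are equal. -/
theorem IsSOBlock.eq_of_mem {C D : Set V} (hC : G.IsSOBlock C) (hD : G.IsSOBlock D)
    {v : V} (hvC : v ∈ C) (hvD : v ∈ D) : C = D := by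
  classical
  obtain ⟨p, hp⟩ := hC.1
  obtain ⟨q, hq⟩ := hD.1
  let o : F → Bool := fun f => if G.ufst f ∈ C ∧ G.usnd f ∈ C then p f else q f
  have hCo : ∀ x ∈ C, ∀ y ∈ C, (G.orient o).Reaches x y := fun x hx y hy =>
    .of_induce <| (hC.induce_reaches hp hx hy).lift fun _ _ h =>
      (step_induce_of_agree (fun f h₁ h₂ => by simp [o, h₁, h₂]) h).reaches
  have hDo : ∀ x y, (G.orient q).Reaches x y → (G.orient o).Reaches x y := by
    refine fun x y h => h.lift ?_
    rintro _ _ ⟨e | f, he, rfl, rfl⟩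
    · exact MultiDigraph.Step.reaches ⟨Sum.inl e, he, rfl, rfl⟩
    · by_cases hf : G.ufst f ∈ C ∧ G.usnd f ∈ C
      · apply hCo <;> cases hqf : q f <;> simp [orient, hqf, hf.1, hf.2]
      · have hof : o f = q f := by simp only [o, if_neg hf]
        exact MultiDigraph.Step.reaches
          ⟨Sum.inr f, he, by simp [orient, hof], by simp [orient, hof]⟩
  have hv : ∀ x ∈ C ∪ D, (G.orient o).SConn x v := by
    rintro x (hx | hx)
    · exact ⟨hCo x hx v hvC, hCo v hvC x hx⟩
    · exact ⟨hDo _ _ (hq x hx v hvD).1, hDo _ _ (hq x hx v hvD).2⟩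
  have hun : G.StronglyOrientable (C ∪ D) := ⟨o, fun x hx y hy =>
    ⟨(hv x hx).1.trans (hv y hy).2, (hv y hy).1.trans (hv x hx).2⟩⟩
  exact (hC.2 _ Set.subset_union_left hun).symm.trans (hD.2 _ Set.subset_union_right hun)

end MixedGraph

/-- For every mixed graph `G` there is a single orientation
`R` of `G` such that, for every strongly orientable block `C` of `G`, the
subgraph of `R` induced by `C` is strongly connected. -/
theorem statement_7 {V E F : Type} (G : MixedGraph V E F) :
    ∃ o : F → Bool, ∀ C : Set V, G.IsSOBlock C →
      ∀ a ∈ C, ∀ b ∈ C, ((G.orient o).induce C).SConn a b := by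
  classical
  choose p hp using fun C : {C : Set V // G.IsSOBlock C} => C.2.1
  let o : F → Bool := fun f =>
    if h : ∃ C : {C : Set V // G.IsSOBlock C}, G.ufst f ∈ C.1 then p h.choose f else true
  have ho : ∀ (C : Set V) (hC : G.IsSOBlock C) (f : F), G.ufst f ∈ C → p ⟨C, hC⟩ f = o f := by
    intro C hC f hf
    have h : ∃ C : {C : Set V // G.IsSOBlock C}, G.ufst f ∈ C.1 := ⟨⟨C, hC⟩, hf⟩
    have hch : h.choose = ⟨C, hC⟩ :=
      Subtype.ext (h.choose.2.eq_of_mem hC h.choose_spec hf)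
    simp only [o, dif_pos h, hch]
  have hreach : ∀ C, G.IsSOBlock C → ∀ a ∈ C, ∀ b ∈ C,
      ((G.orient o).induce C).Reaches a b := fun C hC a ha b hb =>
    (hC.induce_reaches (hp ⟨C, hC⟩) ha hb).lift fun _ _ h =>
      (MixedGraph.step_induce_of_agree (fun f hf _ => ho C hC f hf) h).reaches
  exact ⟨o, fun C hC a ha b hb => ⟨hreach C hC a ha b hb, hreach C hC b hb a ha⟩⟩
end
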